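/- arXiv:1710.04259 — 12 statements merged into one kernel-verified Lean document; each statement's English description precedes it below -/
import Mathlib

section
/- (Lemma: containment in memory order; Lemma 3 / Appendix C) Assume the GAM axioms hold. Then each of the derived relations rfe, co, fr, and the relation ppo is contained in mo: for all events x, y, if x rfe y, or x co y, or x fr y, or x ppo y, then x mo y. -/
universe u v w

/-- A relation is acyclic when its transitive closure is irreflexive. -/
def Acyclic {E : Type u} (r : E → E → Prop) : Prop :=
  ∀ e, ¬ Relation.TransGen r e e

/-- A GAM execution: events (each exactly one of read/write) with addresses and
threads, program order `po`, reads-from `rf`, preserved program order `ppo`,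
and a memory order `mo` satisfying the GAM axioms (Inst-Order and Load-Value). -/
structure GAM (E : Type u) (A : Type v) (T : Type w) where
  isRead : E → Prop
  isWrite : E → Prop
  read_or_write : ∀ e, isRead e ∨ isWrite e
  not_read_and_write : ∀ e, ¬ (isRead e ∧ isWrite e)
  addr : E → A
  tid : E → T
  po : E → E → Prop
  po_irrefl : ∀ e, ¬ po e e
  po_trans : ∀ {a b c}, po a b → po b c → po a c
  po_same_tid : ∀ {a b}, po a b → tid a = tid b
  po_total : ∀ a b, tid a = tid b → a ≠ b → po a b ∨ po b a
  rf : E → E → Prop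
  rf_write : ∀ {w r}, rf w r → isWrite w
  rf_read : ∀ {w r}, rf w r → isRead r
  rf_addr : ∀ {w r}, rf w r → addr w = addr r
  rf_unique : ∀ r, isRead r → ∃! w, rf w r
  ppo : E → E → Prop
  ppo_sub_po : ∀ {a b}, ppo a b → po a b
  ppo_rw : ∀ {r w}, isRead r → isWrite w → addr r = addr w → po r w → ppo r w
  ppo_ww : ∀ {w₁ w₂}, isWrite w₁ → isWrite w₂ → addr w₁ = addr w₂ → po w₁ w₂ → ppo w₁ w₂
  ppo_rr : ∀ {r₁ r₂}, isRead r₁ → isRead r₂ → addr r₁ = addr r₂ → po r₁ r₂ →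
      (∀ w, isWrite w → addr w = addr r₁ → po r₁ w → ¬ po w r₂) → ppo r₁ r₂
  mo : E → E → Prop
  mo_irrefl : ∀ e, ¬ mo e e
  mo_trans : ∀ {a b c}, mo a b → mo b c → mo a c
  mo_total : ∀ a b, a ≠ b → mo a b ∨ mo b a
  /-- GAM axiom Inst-Order: `ppo ⊆ mo`. -/
  inst_order : ∀ {a b}, ppo a b → mo a b
  /-- GAM axiom Load-Value, membership part: the write read by `r` is in the
  candidate set, i.e. it precedes `r` in `po` or in `mo`. -/
  load_value_mem : ∀ {w r}, rf w r → po w r ∨ mo w r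
  /-- GAM axiom Load-Value, maximality part: the write read by `r` is the
  `mo`-greatest element of the candidate set. -/
  load_value_max : ∀ {w r}, rf w r → ∀ w', isWrite w' → addr w' = addr r →
      (po w' r ∨ mo w' r) → w' ≠ w → mo w' w

namespace GAM

variable {E : Type u} {A : Type v} {T : Type w} (M : GAM E A T)

/-- Reads-from external: reads-from edges between different threads. -/
def rfe (x y : E) : Prop := M.rf x y ∧ M.tid x ≠ M.tid y

/-- Coherence: `mo` restricted to pairs of same-address writes. -/
def co (x y : E) : Prop := M.mo x y ∧ M.isWrite x ∧ M.isWrite y ∧ M.addr x = M.addr y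

/-- From-reads: `rf⁻¹ ; co`. -/
def fr (x y : E) : Prop := ∃ w, M.rf w x ∧ M.co w y

/-- Program order restricted to same-address pairs. -/
def poloc (x y : E) : Prop := M.po x y ∧ M.addr x = M.addr y

/-- `eco = co ∪ fr ∪ (co* ; rf) ∪ (rf⁻¹ ; co* ; rf)`. -/
def eco (x y : E) : Prop :=
  M.co x y ∨ M.fr x y ∨
  (∃ z, Relation.ReflTransGen M.co x z ∧ M.rf z y) ∨
  (∃ z z', M.rf z x ∧ Relation.ReflTransGen M.co z z' ∧ M.rf z' y)

end GAM

/-- Lemma 3 (containment in memory order): under the GAM axioms, each of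
`rfe`, `co`, `fr`, and `ppo` is contained in `mo`. -/
theorem gam_com_rels_in_mo {E : Type u} {A : Type v} {T : Type w} (M : GAM E A T) :
    ∀ x y : E, (M.rfe x y ∨ M.co x y ∨ M.fr x y ∨ M.ppo x y) → M.mo x y := by
  rintro x y (⟨hrf, htid⟩ | hco | ⟨w, hrf, hmo, hw, hy, haddr⟩ | hppo)
  · exact (M.load_value_mem hrf).resolve_left fun hpo => htid (M.po_same_tid hpo)
  · exact hco.1
  · have hxy : x ≠ y := by
      rintro rfl
      exact M.not_read_and_write x ⟨M.rf_read hrf, hy⟩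
    refine (M.mo_total x y hxy).resolve_right fun hyx => ?_
    have hyw : y ≠ w := by
      rintro rfl
      exact M.mo_irrefl y hmo
    have hmo' : M.mo y w :=
      M.load_value_max hrf y hy (haddr.symm.trans (M.rf_addr hrf)) (Or.inr hyx) hyw
    exact M.mo_irrefl y (M.mo_trans hmo' hmo)
  · exact M.inst_order hppo
end

section
/- (Theorem: the Causality axiom is satisfied) Assume the GAM axioms hold. Then the relation rfe ∪ co ∪ fr ∪ ppo is acyclic. -/
universe u v w

namespace GAM

variable {E : Type u} {A : Type v} {T : Type w} (M : GAM E A T)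

theorem mo_of_rfe {x y : E} (h : M.rfe x y) : M.mo x y :=
  (M.load_value_mem h.1).resolve_left fun hpo => h.2 (M.po_same_tid hpo)

theorem mo_of_fr {x y : E} (h : M.fr x y) : M.mo x y := by
  obtain ⟨w, hrf, hmo, -, hy, haddr⟩ := h
  have hne : x ≠ y := by
    rintro rfl
    exact M.not_read_and_write x ⟨M.rf_read hrf, hy⟩
  refine (M.mo_total x y hne).resolve_right fun hyx => ?_
  have hyw : y ≠ w := by
    rintro rfl
    exact M.mo_irrefl y hmo
  exact M.mo_irrefl w (M.mo_trans hmo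
    (M.load_value_max hrf y hy (haddr.symm.trans (M.rf_addr hrf)) (Or.inr hyx) hyw))

end GAM

/-- Theorem (Causality): under the GAM axioms, `rfe ∪ co ∪ fr ∪ ppo` is acyclic. -/
theorem gam_causality {E : Type u} {A : Type v} {T : Type w} (M : GAM E A T) :
    Acyclic (fun x y : E => M.rfe x y ∨ M.co x y ∨ M.fr x y ∨ M.ppo x y) := by
  have transGen_le_mo {a b : E}
      (h : Relation.TransGen (fun x y => M.rfe x y ∨ M.co x y ∨ M.fr x y ∨ M.ppo x y) a b) :
      M.mo a b := by
    have step {x y : E} (h : M.rfe x y ∨ M.co x y ∨ M.fr x y ∨ M.ppo x y) : M.mo x y := by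
      rcases h with h | h | h | h
      exacts [M.mo_of_rfe h, h.1, M.mo_of_fr h, M.inst_order h]
    induction h with
    | single h => exact step h
    | tail _ h ih => exact M.mo_trans ih (step h)
  exact fun e h => M.mo_irrefl e (transGen_le_mo h)
end

section
/- (Lemma: eco relates all same-address pairs) Assume the GAM axioms hold. Then for any two distinct events i1 and i2 with addr i1 = addr i2, either i1 eco i2 or i2 eco i1. -/
universe u v w

namespace GAM

/-- Two writes to the same address are equal or ordered by coherence. -/
theorem co_trichotomous {E : Type u} {A : Type v} {T : Type w} (M : GAM E A T) {x y : E}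
    (hx : M.isWrite x) (hy : M.isWrite y) (ha : M.addr x = M.addr y) :
    x = y ∨ M.co x y ∨ M.co y x := by
  by_cases h : x = y
  · exact .inl h
  · exact .inr ((M.mo_total x y h).imp (⟨·, hx, hy, ha⟩) (⟨·, hy, hx, ha.symm⟩))

/-- A write and a read of the same address are related by `eco` in some direction. -/
theorem eco_write_read_total {E : Type u} {A : Type v} {T : Type w} (M : GAM E A T) {x r : E}
    (hx : M.isWrite x) (hr : M.isRead r) (ha : M.addr x = M.addr r) :
    M.eco x r ∨ M.eco r x := by
  obtain ⟨z, hz, -⟩ := M.rf_unique r hr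
  rcases M.co_trichotomous hx (M.rf_write hz) (ha.trans (M.rf_addr hz).symm) with rfl | h | h
  · exact .inl (.inr (.inr (.inl ⟨x, .refl, hz⟩)))
  · exact .inl (.inr (.inr (.inl ⟨z, .single h, hz⟩)))
  · exact .inr (.inr (.inl ⟨z, hz, h⟩))

end GAM

/-- Lemma (`eco` relates all same-address pairs): under the GAM axioms, any two
distinct events with the same address are related by `eco` in one direction or
the other. -/
theorem gam_eco_total {E : Type u} {A : Type v} {T : Type w} (M : GAM E A T)
    (i₁ i₂ : E) (hne : i₁ ≠ i₂) (ha : M.addr i₁ = M.addr i₂) :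
    M.eco i₁ i₂ ∨ M.eco i₂ i₁ := by
  rcases M.read_or_write i₁ with h₁ | h₁ <;> rcases M.read_or_write i₂ with h₂ | h₂
  · obtain ⟨w₁, hw₁, -⟩ := M.rf_unique i₁ h₁
    obtain ⟨w₂, hw₂, -⟩ := M.rf_unique i₂ h₂
    have hw : M.addr w₁ = M.addr w₂ :=
      (M.rf_addr hw₁).trans (ha.trans (M.rf_addr hw₂).symm)
    rcases M.co_trichotomous (M.rf_write hw₁) (M.rf_write hw₂) hw with rfl | h | h
    · exact .inl (.inr (.inr (.inr ⟨w₁, w₁, hw₁, .refl, hw₂⟩)))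
    · exact .inl (.inr (.inr (.inr ⟨w₁, w₂, hw₁, .single h, hw₂⟩)))
    · exact .inr (.inr (.inr (.inr ⟨w₂, w₁, hw₂, .single h, hw₁⟩)))
  · exact (M.eco_write_read_total h₂ h₁ ha.symm).symm
  · exact M.eco_write_read_total h₁ h₂ ha
  · rcases M.co_trichotomous h₁ h₂ ha with h | h | h
    · exact absurd h hne
    · exact .inl (.inl h)
    · exact .inr (.inl h)
end

section
/- (Lemma: poloc is contained in eco) Assume the GAM axioms hold. Then poloc ⊆ eco: for all events i1, i2, if i1 po i2 and addr i1 = addr i2, then i1 eco i2. -/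
universe u v w

namespace GAM

variable {E : Type u} {A : Type v} {T : Type w} (M : GAM E A T)

/-- A write that precedes a same-address read in `po` or `mo` is `co*`-before the write
which that read reads from. -/
theorem co_star_of_candidate {x w r : E} (hrf : M.rf w r) (hx : M.isWrite x)
    (ha : M.addr x = M.addr r) (h : M.po x r ∨ M.mo x r) :
    Relation.ReflTransGen M.co x w := by
  by_cases hxw : x = w
  · exact hxw ▸ .refl
  · exact .single ⟨M.load_value_max hrf x hx ha h hxw, hx, M.rf_write hrf,
      ha.trans (M.rf_addr hrf).symm⟩

/-- A write which is `po`-before a same-address write is `co`-before it. -/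
theorem co_of_po {x y : E} (hx : M.isWrite x) (hy : M.isWrite y)
    (ha : M.addr x = M.addr y) (h : M.po x y) : M.co x y :=
  ⟨M.inst_order (M.ppo_ww hx hy ha h), hx, hy, ha⟩

/-- The write read by a read is `co`-before every same-address write `po`-after that read. -/
theorem co_of_rf_of_po {x r y : E} (hrf : M.rf x r) (hy : M.isWrite y)
    (ha : M.addr r = M.addr y) (h : M.po r y) : M.co x y := by
  have hxy := (M.rf_addr hrf).trans ha
  rcases M.load_value_mem hrf with hpo | hmo
  · exact M.co_of_po (M.rf_write hrf) hy hxy (M.po_trans hpo h)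
  · exact ⟨M.mo_trans hmo (M.inst_order (M.ppo_rw (M.rf_read hrf) hy ha h)),
      M.rf_write hrf, hy, hxy⟩

/-- Same-address reads in program order read from writes related by `co*`. -/
theorem co_star_of_rf_of_po_of_rf {x y r s : E} (hx : M.rf x r) (hy : M.rf y s)
    (ha : M.addr r = M.addr s) (h : M.po r s) : Relation.ReflTransGen M.co x y := by
  by_cases hw : ∃ z, M.isWrite z ∧ M.addr z = M.addr r ∧ M.po r z ∧ M.po z s
  · obtain ⟨z, hz, hzr, hrz, hzs⟩ := hw
    exact .head (M.co_of_rf_of_po hx hz hzr.symm hrz)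
      (M.co_star_of_candidate hy hz (hzr.trans ha) (.inl hzs))
  · have hmo : M.mo r s := M.inst_order (M.ppo_rr (M.rf_read hx) (M.rf_read hy) ha h
      fun z hz hzr hrz hzs => hw ⟨z, hz, hzr, hrz, hzs⟩)
    exact M.co_star_of_candidate hy (M.rf_write hx) ((M.rf_addr hx).trans ha)
      ((M.load_value_mem hx).imp (fun hp => M.po_trans hp h) (fun hm => M.mo_trans hm hmo))

end GAM

/-- Lemma (`poloc ⊆ eco`): under the GAM axioms, if `i₁ po i₂` and the two
events have the same address, then `i₁ eco i₂`. -/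
theorem gam_poloc_in_eco {E : Type u} {A : Type v} {T : Type w} (M : GAM E A T)
    (i₁ i₂ : E) (hpo : M.po i₁ i₂) (ha : M.addr i₁ = M.addr i₂) :
    M.eco i₁ i₂ := by
  rcases M.read_or_write i₁ with h₁ | h₁
  · obtain ⟨x, hx, -⟩ := M.rf_unique i₁ h₁
    rcases M.read_or_write i₂ with h₂ | h₂
    · obtain ⟨y, hy, -⟩ := M.rf_unique i₂ h₂
      exact .inr (.inr (.inr ⟨x, y, hx, M.co_star_of_rf_of_po_of_rf hx hy ha hpo, hy⟩))
    · exact .inr (.inl ⟨x, hx, M.co_of_rf_of_po hx h₂ ha hpo⟩)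
  · rcases M.read_or_write i₂ with h₂ | h₂
    · obtain ⟨y, hy, -⟩ := M.rf_unique i₂ h₂
      exact .inr (.inr (.inl ⟨y, M.co_star_of_candidate hy h₁ ha (.inl hpo), hy⟩))
    · exact .inl (M.co_of_po h₁ h₂ ha hpo)
end

section
/- (Theorem: the SC-per-Location axiom is satisfied) Assume the GAM axioms hold. Then the relation rf ∪ co ∪ fr ∪ poloc is acyclic. -/
universe u v w

namespace GAM

variable {E : Type u} {A : Type v} {T : Type w} (M : GAM E A T)

theorem rf_source_unique {w₁ w₂ r : E} (h₁ : M.rf w₁ r) (h₂ : M.rf w₂ r) : w₁ = w₂ :=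
  (M.rf_unique r (M.rf_read h₁)).unique h₁ h₂

/-- The write whose value an event carries: a write carries its own value and a read that of the
write it reads from. -/
theorem exists_source (e : E) : ∃ s, (M.isWrite e ∧ s = e) ∨ M.rf s e := by
  rcases M.read_or_write e with h | h
  · obtain ⟨s, hs, -⟩ := M.rf_unique e h
    exact ⟨s, Or.inr hs⟩
  · exact ⟨e, Or.inl ⟨h, rfl⟩⟩

/-- A write that is a candidate for `r` is `mo`-below or equal to the write `r` reads from. -/
theorem eq_or_mo_of_candidate {s r w : E} (hs : M.rf s r) (hw : M.isWrite w)
    (ha : M.addr w = M.addr r) (h : M.po w r ∨ M.mo w r) : w = s ∨ M.mo w s := by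
  by_cases hws : w = s
  · exact Or.inl hws
  · exact Or.inr (M.load_value_max hs w hw ha h hws)

/-- A read followed in program order by a same-address write reads from a `mo`-earlier write. -/
theorem mo_of_rf_of_po_write {s r w : E} (hs : M.rf s r) (hw : M.isWrite w)
    (ha : M.addr r = M.addr w) (h : M.po r w) : M.mo s w := by
  rcases M.load_value_mem hs with hp | hm
  · exact M.inst_order
      (M.ppo_ww (M.rf_write hs) hw ((M.rf_addr hs).trans ha) (M.po_trans hp h))
  · exact M.mo_trans hm (M.inst_order (M.ppo_rw (M.rf_read hs) hw ha h))

/-- Program-ordered reads of the same address read from `mo`-ordered or equal writes. -/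
theorem eq_or_mo_of_po_reads {s₁ s₂ r₁ r₂ : E} (h₁ : M.rf s₁ r₁) (h₂ : M.rf s₂ r₂)
    (ha : M.addr r₁ = M.addr r₂) (h : M.po r₁ r₂) : s₁ = s₂ ∨ M.mo s₁ s₂ := by
  by_cases hb : ∃ w, M.isWrite w ∧ M.addr w = M.addr r₁ ∧ M.po r₁ w ∧ M.po w r₂
  · obtain ⟨w, hw, haw, hp₁, hp₂⟩ := hb
    have hm := M.mo_of_rf_of_po_write h₁ hw haw.symm hp₁
    rcases M.eq_or_mo_of_candidate h₂ hw (haw.trans ha) (Or.inl hp₂) with rfl | hm'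
    · exact Or.inr hm
    · exact Or.inr (M.mo_trans hm hm')
  · refine M.eq_or_mo_of_candidate h₂ (M.rf_write h₁) ((M.rf_addr h₁).trans ha) ?_
    rcases M.load_value_mem h₁ with hp | hm
    · exact Or.inl (M.po_trans hp h)
    · exact Or.inr (M.mo_trans hm (M.inst_order (M.ppo_rr (M.rf_read h₁) (M.rf_read h₂) ha h
        fun w hw haw hp₁ hp₂ => hb ⟨w, hw, haw, hp₁, hp₂⟩)))

/-- Lexicographic order on events: first the `mo`-order of the carried writes, then a write before
its readers, then program order between readers. -/
def sourceLex (src : E → E) (x y : E) : Prop :=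
  M.mo (src x) (src y) ∨
    src x = src y ∧ (M.isWrite x ∧ M.isRead y ∨ M.isRead x ∧ M.isRead y ∧ M.po x y)

theorem sourceLex_irrefl (src : E → E) (x : E) : ¬ M.sourceLex src x x := by
  rintro (h | ⟨-, ⟨hw, hr⟩ | ⟨-, -, h⟩⟩)
  · exact M.mo_irrefl _ h
  · exact M.not_read_and_write x ⟨hr, hw⟩
  · exact M.po_irrefl x h

theorem sourceLex_trans (src : E → E) {x y z : E} (hxy : M.sourceLex src x y)
    (hyz : M.sourceLex src y z) : M.sourceLex src x z := by
  rcases hxy with hxy | ⟨exy, hxy⟩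
  · rcases hyz with hyz | ⟨eyz, -⟩
    · exact Or.inl (M.mo_trans hxy hyz)
    · exact Or.inl (eyz ▸ hxy)
  · rcases hyz with hyz | ⟨eyz, hyz⟩
    · exact Or.inl (exy.symm ▸ hyz)
    · refine Or.inr ⟨exy.trans eyz, ?_⟩
      rcases hxy with ⟨hx, hy⟩ | ⟨hx, hy, hp⟩ <;> rcases hyz with ⟨hy', hz⟩ | ⟨-, hz, hp'⟩
      · exact Or.inl ⟨hx, hz⟩
      · exact Or.inl ⟨hx, hz⟩
      · exact (M.not_read_and_write y ⟨hy, hy'⟩).elim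
      · exact Or.inr ⟨hx, hz, M.po_trans hp hp'⟩

theorem source_of_isWrite {src : E → E}
    (hsrc : ∀ e, (M.isWrite e ∧ src e = e) ∨ M.rf (src e) e)
    {w : E} (hw : M.isWrite w) : src w = w := by
  rcases hsrc w with h | h
  · exact h.2
  · exact (M.not_read_and_write w ⟨M.rf_read h, hw⟩).elim

theorem source_of_rf {src : E → E}
    (hsrc : ∀ e, (M.isWrite e ∧ src e = e) ∨ M.rf (src e) e)
    {w r : E} (h : M.rf w r) : src r = w := by
  rcases hsrc r with h' | h'
  · exact (M.not_read_and_write r ⟨M.rf_read h, h'.1⟩).elim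
  · exact M.rf_source_unique h' h

theorem sourceLex_of_poloc {src : E → E}
    (hsrc : ∀ e, (M.isWrite e ∧ src e = e) ∨ M.rf (src e) e)
    {x y : E} (h : M.poloc x y) : M.sourceLex src x y := by
  obtain ⟨hp, ha⟩ := h
  rcases hsrc x with ⟨hx, ex⟩ | hx <;> rcases hsrc y with ⟨hy, ey⟩ | hy
  · refine Or.inl ?_
    rw [ex, ey]
    exact M.inst_order (M.ppo_ww hx hy ha hp)
  · rcases M.eq_or_mo_of_candidate hy hx ha (Or.inl hp) with h | h
    · exact Or.inr ⟨ex.trans h, Or.inl ⟨hx, M.rf_read hy⟩⟩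
    · exact Or.inl (ex.symm ▸ h)
  · refine Or.inl ?_
    rw [ey]
    exact M.mo_of_rf_of_po_write hx hy ha hp
  · rcases M.eq_or_mo_of_po_reads hx hy ha hp with h | h
    · exact Or.inr ⟨h, Or.inr ⟨M.rf_read hx, M.rf_read hy, hp⟩⟩
    · exact Or.inl h

theorem sourceLex_of_edge {src : E → E}
    (hsrc : ∀ e, (M.isWrite e ∧ src e = e) ∨ M.rf (src e) e)
    {x y : E} (h : M.rf x y ∨ M.co x y ∨ M.fr x y ∨ M.poloc x y) : M.sourceLex src x y := by
  rcases h with h | ⟨hm, hx, hy, -⟩ | ⟨w, hw, hm, -, hy, -⟩ | h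
  · exact Or.inr ⟨(M.source_of_isWrite hsrc (M.rf_write h)).trans (M.source_of_rf hsrc h).symm,
      Or.inl ⟨M.rf_write h, M.rf_read h⟩⟩
  · refine Or.inl ?_
    rwa [M.source_of_isWrite hsrc hx, M.source_of_isWrite hsrc hy]
  · refine Or.inl ?_
    rwa [M.source_of_rf hsrc hw, M.source_of_isWrite hsrc hy]
  · exact M.sourceLex_of_poloc hsrc h

end GAM

/-- Theorem (SC-per-Location): under the GAM axioms, `rf ∪ co ∪ fr ∪ poloc`
is acyclic. -/
theorem gam_sc_per_location {E : Type u} {A : Type v} {T : Type w} (M : GAM E A T) :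
    Acyclic (fun x y : E => M.rf x y ∨ M.co x y ∨ M.fr x y ∨ M.poloc x y) := by
  choose src hsrc using M.exists_source
  have key : ∀ x y, Relation.TransGen
      (fun x y : E => M.rf x y ∨ M.co x y ∨ M.fr x y ∨ M.poloc x y) x y →
      M.sourceLex src x y := by
    intro x y h
    induction h with
    | single h => exact M.sourceLex_of_edge hsrc h
    | tail _ h ih => exact M.sourceLex_trans src ih (M.sourceLex_of_edge hsrc h)
  exact fun e he => M.sourceLex_irrefl src e (key e e he)
end

section
/- (Theorem: COM ⊆ GAM, Load-Value for any linear extension) Assume the COM axioms hold, and let mo be any strict total order on E that contains rfe ∪ co ∪ fr ∪ ppo. Then the Load-Value axiom holds for mo: if w rf r then w is the mo-greatest element of the set { w' : w' is a write, addr w' = addr r, and (w' po r or w' mo r) }. In particular, since ppo ⊆ mo by construction, (po, rf, mo, ppo) satisfies both GAM axioms. -/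
universe u v w

/-- A COM execution: events (each exactly one of read/write) with addresses and
threads, program order `po`, reads-from `rf`, preserved program order `ppo`,
and a coherence order `co` (a per-address strict total order on writes). -/
structure COM (E : Type u) (A : Type v) (T : Type w) where
  isRead : E → Prop
  isWrite : E → Prop
  read_or_write : ∀ e, isRead e ∨ isWrite e
  not_read_and_write : ∀ e, ¬ (isRead e ∧ isWrite e)
  addr : E → A
  tid : E → T
  po : E → E → Prop
  po_irrefl : ∀ e, ¬ po e e
  po_trans : ∀ {a b c}, po a b → po b c → po a c
  po_same_tid : ∀ {a b}, po a b → tid a = tid b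
  po_total : ∀ a b, tid a = tid b → a ≠ b → po a b ∨ po b a
  rf : E → E → Prop
  rf_write : ∀ {w r}, rf w r → isWrite w
  rf_read : ∀ {w r}, rf w r → isRead r
  rf_addr : ∀ {w r}, rf w r → addr w = addr r
  rf_unique : ∀ r, isRead r → ∃! w, rf w r
  ppo : E → E → Prop
  ppo_sub_po : ∀ {a b}, ppo a b → po a b
  ppo_rw : ∀ {r w}, isRead r → isWrite w → addr r = addr w → po r w → ppo r w
  ppo_ww : ∀ {w₁ w₂}, isWrite w₁ → isWrite w₂ → addr w₁ = addr w₂ → po w₁ w₂ → ppo w₁ w₂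
  ppo_rr : ∀ {r₁ r₂}, isRead r₁ → isRead r₂ → addr r₁ = addr r₂ → po r₁ r₂ →
      (∀ w, isWrite w → addr w = addr r₁ → po r₁ w → ¬ po w r₂) → ppo r₁ r₂
  co : E → E → Prop
  co_writes : ∀ {a b}, co a b → isWrite a ∧ isWrite b ∧ addr a = addr b
  co_irrefl : ∀ a, ¬ co a a
  co_trans : ∀ {a b c}, co a b → co b c → co a c
  co_total : ∀ a b, isWrite a → isWrite b → addr a = addr b → a ≠ b → co a b ∨ co b a

namespace COM

variable {E : Type u} {A : Type v} {T : Type w} (M : COM E A T)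

/-- Reads-from external: reads-from edges between different threads. -/
def rfe (x y : E) : Prop := M.rf x y ∧ M.tid x ≠ M.tid y

/-- From-reads: `rf⁻¹ ; co`. -/
def fr (x y : E) : Prop := ∃ w, M.rf w x ∧ M.co w y

/-- Program order restricted to same-address pairs. -/
def poloc (x y : E) : Prop := M.po x y ∧ M.addr x = M.addr y

/-- COM axiom SC-per-Location: `rf ∪ co ∪ fr ∪ poloc` is acyclic. -/
def ScPerLocation : Prop :=
  Acyclic (fun x y => M.rf x y ∨ M.co x y ∨ M.fr x y ∨ M.poloc x y)

/-- COM axiom Causality: `rfe ∪ co ∪ fr ∪ ppo` is acyclic. -/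
def Causality : Prop :=
  Acyclic (fun x y => M.rfe x y ∨ M.co x y ∨ M.fr x y ∨ M.ppo x y)

end COM

/-- Theorem (COM ⊆ GAM, Load-Value for any linear extension): assume the COM
axioms hold and let `mo` be any strict total order containing
`rfe ∪ co ∪ fr ∪ ppo`. Then `(po, rf, mo, ppo)` satisfies both GAM axioms:
Inst-Order (`ppo ⊆ mo`) and Load-Value (`w rf r` implies `w` is the
`mo`-greatest element of the candidate set
`{ w' : w' is a write, addr w' = addr r, and (w' po r or w' mo r) }`). -/
theorem com_subset_gam_load_value {E : Type u} {A : Type v} {T : Type w} (M : COM E A T)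
    (hSC : M.ScPerLocation) (hCaus : M.Causality)
    (mo : E → E → Prop)
    (mo_irrefl : ∀ e, ¬ mo e e)
    (mo_trans : ∀ {a b c}, mo a b → mo b c → mo a c)
    (mo_total : ∀ a b, a ≠ b → mo a b ∨ mo b a)
    (hsub : ∀ x y, (M.rfe x y ∨ M.co x y ∨ M.fr x y ∨ M.ppo x y) → mo x y) :
    (∀ x y, M.ppo x y → mo x y) ∧
    (∀ w r, M.rf w r →
      (M.isWrite w ∧ M.addr w = M.addr r ∧ (M.po w r ∨ mo w r)) ∧
      (∀ w', M.isWrite w' → M.addr w' = M.addr r → (M.po w' r ∨ mo w' r) →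
        w' ≠ w → mo w' w)) := by
  refine ⟨fun x y h => hsub x y (.inr (.inr (.inr h))), fun w r hrf => ⟨?_, ?_⟩⟩
  · refine ⟨M.rf_write hrf, M.rf_addr hrf, ?_⟩
    by_cases htid : M.tid w = M.tid r
    · have hne : w ≠ r := by
        rintro rfl
        exact M.not_read_and_write w ⟨M.rf_read hrf, M.rf_write hrf⟩
      refine .inl ((M.po_total w r htid hne).resolve_right fun hpo => ?_)
      exact hSC w (.tail (.single (.inl hrf)) (.inr (.inr (.inr ⟨hpo, (M.rf_addr hrf).symm⟩))))
    · exact .inr (hsub w r (.inl ⟨hrf, htid⟩))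
  · intro w' hw' haddr hord hne
    rcases M.co_total w' w hw' (M.rf_write hrf) (haddr.trans (M.rf_addr hrf).symm) hne with
      hco | hco
    · exact hsub w' w (.inr (.inl hco))
    · have hfr : M.fr r w' := ⟨w, hrf, hco⟩
      rcases hord with hpo | hmo
      · exact (hSC r (.tail (.single (.inr (.inr (.inl hfr))))
          (.inr (.inr (.inr ⟨hpo, haddr⟩))))).elim
      · exact (mo_irrefl r (mo_trans (hsub r w' (.inr (.inr (.inl hfr)))) hmo)).elim
end

section
/- (Claim used in the SC-per-Location proof: communication relations are acyclic) Assume the GAM axioms hold. Then the relation rf ∪ co ∪ fr is acyclic. -/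
universe u v w

namespace GAM

/-- `M.Source e w` says that `w` is the write whose value `e` carries: `e` itself if `e` is a
write, and the write that `e` reads from if `e` is a read. -/
def Source {E : Type u} {A : Type v} {T : Type w} (M : GAM E A T) (e a : E) : Prop :=
  (M.isWrite e ∧ a = e) ∨ M.rf a e

theorem Source.unique {E : Type u} {A : Type v} {T : Type w} {M : GAM E A T} {e a b : E}
    (ha : M.Source e a) (hb : M.Source e b) : a = b := by
  rcases ha with ⟨hw, rfl⟩ | ha <;> rcases hb with ⟨hw', rfl⟩ | hb
  · rfl
  · exact (M.not_read_and_write _ ⟨M.rf_read hb, hw⟩).elim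
  · exact (M.not_read_and_write _ ⟨M.rf_read ha, hw'⟩).elim
  · exact (M.rf_unique e (M.rf_read ha)).unique ha hb

/-- Events ordered by the memory order of their source writes, each write preceding the reads
that read from it. -/
def SourceLT {E : Type u} {A : Type v} {T : Type w} (M : GAM E A T) (x y : E) : Prop :=
  ∃ a b, M.Source x a ∧ M.Source y b ∧ (M.mo a b ∨ (a = b ∧ M.isWrite x ∧ M.isRead y))

theorem sourceLT_irrefl {E : Type u} {A : Type v} {T : Type w} (M : GAM E A T) (x : E) :
    ¬ M.SourceLT x x := by
  rintro ⟨a, b, ha, hb, h | ⟨-, hw, hr⟩⟩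
  · exact M.mo_irrefl a (hb.unique ha ▸ h)
  · exact M.not_read_and_write x ⟨hr, hw⟩

theorem SourceLT.trans {E : Type u} {A : Type v} {T : Type w} {M : GAM E A T} {x y z : E}
    (hxy : M.SourceLT x y) (hyz : M.SourceLT y z) : M.SourceLT x z := by
  obtain ⟨a, b, ha, hb, h⟩ := hxy
  obtain ⟨b', c, hb', hc, h'⟩ := hyz
  obtain rfl := hb.unique hb'
  refine ⟨a, c, ha, hc, ?_⟩
  rcases h with h | ⟨rfl, hx, hy⟩ <;> rcases h' with h' | ⟨rfl, hy', hz⟩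
  · exact Or.inl (M.mo_trans h h')
  · exact Or.inl h
  · exact Or.inl h'
  · exact Or.inr ⟨rfl, hx, hz⟩

theorem sourceLT_of_com {E : Type u} {A : Type v} {T : Type w} (M : GAM E A T) {x y : E}
    (h : M.rf x y ∨ M.co x y ∨ M.fr x y) : M.SourceLT x y := by
  rcases h with h | ⟨h, hx, hy, -⟩ | ⟨a, ha, h, -, hy, -⟩
  · exact ⟨x, x, Or.inl ⟨M.rf_write h, rfl⟩, Or.inr h, Or.inr ⟨rfl, M.rf_write h, M.rf_read h⟩⟩
  · exact ⟨x, y, Or.inl ⟨hx, rfl⟩, Or.inl ⟨hy, rfl⟩, Or.inl h⟩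
  · exact ⟨a, y, Or.inr ha, Or.inl ⟨hy, rfl⟩, Or.inl h⟩

end GAM

/-- Claim used in the SC-per-Location proof: under the GAM axioms, the union of
the communication relations `rf ∪ co ∪ fr` is acyclic. -/
theorem gam_com_acyclic {E : Type u} {A : Type v} {T : Type w} (M : GAM E A T) :
    Acyclic (fun x y : E => M.rf x y ∨ M.co x y ∨ M.fr x y) := by
  intro e he
  refine M.sourceLT_irrefl e ?_
  have lift : ∀ {y}, Relation.TransGen (fun x y : E => M.rf x y ∨ M.co x y ∨ M.fr x y) e y →
      M.SourceLT e y := by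
    intro y h
    induction h with
    | single h => exact M.sourceLT_of_com h
    | tail _ h ih => exact ih.trans (M.sourceLT_of_com h)
  exact lift he
end

section
/- (Case of the poloc-in-eco lemma: read program-order-before a same-address write) Assume the GAM axioms hold. Let r be a read and w a write with addr r = addr w and r po w. Then r fr w; equivalently, the unique write w' with w' rf r satisfies w' co w. -/
universe u v w

/-- Case of the `poloc ⊆ eco` lemma: under the GAM axioms, if a read `r`
precedes a same-address write `w` in program order, then `r fr w`;
equivalently, every write `w'` with `w' rf r` satisfies `w' co w`. -/
theorem gam_read_po_write_fr {E : Type u} {A : Type v} {T : Type w} (M : GAM E A T)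
    (r w : E) (hr : M.isRead r) (hw : M.isWrite w)
    (ha : M.addr r = M.addr w) (hpo : M.po r w) :
    M.fr r w ∧ (∀ w', M.rf w' r → M.co w' w) := by
  have hco : ∀ w', M.rf w' r → M.co w' w := by
    intro w' hrf
    have hw' := M.rf_write hrf
    have haddr := (M.rf_addr hrf).trans ha
    refine ⟨?_, hw', hw, haddr⟩
    rcases M.load_value_mem hrf with h | h
    · exact M.inst_order (M.ppo_ww hw' hw haddr (M.po_trans h hpo))
    · exact M.mo_trans h (M.inst_order (M.ppo_rw hr hw ha hpo))
  obtain ⟨w₀, hw₀, -⟩ := M.rf_unique r hr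
  exact ⟨⟨w₀, hw₀, hco w₀ hw₀⟩, hco⟩
end

section
/- (Case of the poloc-in-eco lemma: write program-order-before a same-address read) Assume the GAM axioms hold. Let w be a write and r a read with addr w = addr r and w po r. Then either w rf r, or there exists a write w' with w co w' and w' rf r. -/
universe u v w

/-- Case of the `poloc ⊆ eco` lemma: under the GAM axioms, if a write `w`
precedes a same-address read `r` in program order, then either `w rf r`, or
there is a write `w'` with `w co w'` and `w' rf r`. -/
theorem gam_write_po_read {E : Type u} {A : Type v} {T : Type w} (M : GAM E A T)
    (w r : E) (hw : M.isWrite w) (hr : M.isRead r)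
    (ha : M.addr w = M.addr r) (hpo : M.po w r) :
    M.rf w r ∨ ∃ w', M.co w w' ∧ M.rf w' r := by
  obtain ⟨w', hrf, -⟩ := M.rf_unique r hr
  by_cases h : w = w'
  · exact Or.inl (h ▸ hrf)
  · exact Or.inr ⟨w', ⟨M.load_value_max hrf w hw ha (Or.inl hpo) h, hw, M.rf_write hrf,
      ha.trans (M.rf_addr hrf).symm⟩, hrf⟩
end

section
/- (Case of the poloc-in-eco lemma: two same-address reads in program order) Assume the GAM axioms hold. Let r1 and r2 be reads with addr r1 = addr r2 and r1 po r2, and let w1 and w2 be the writes with w1 rf r1 and w2 rf r2. Then either w1 = w2 or w1 co w2. -/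
universe u v w

/-- Case of the `poloc ⊆ eco` lemma: under the GAM axioms, if reads `r₁`, `r₂`
to the same address satisfy `r₁ po r₂` and read from writes `w₁`, `w₂`
respectively, then `w₁ = w₂` or `w₁ co w₂`. -/
theorem gam_read_po_read {E : Type u} {A : Type v} {T : Type w} (M : GAM E A T)
    (r₁ r₂ w₁ w₂ : E) (hr₁ : M.isRead r₁) (hr₂ : M.isRead r₂)
    (ha : M.addr r₁ = M.addr r₂) (hpo : M.po r₁ r₂)
    (hrf₁ : M.rf w₁ r₁) (hrf₂ : M.rf w₂ r₂) :
    w₁ = w₂ ∨ M.co w₁ w₂ := by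
  by_cases hne : w₁ = w₂
  · exact Or.inl hne
  refine Or.inr ⟨?_, M.rf_write hrf₁, M.rf_write hrf₂,
    (M.rf_addr hrf₁).trans (ha.trans (M.rf_addr hrf₂).symm)⟩
  have visible (h : M.po w₁ r₂ ∨ M.mo w₁ r₂) : M.mo w₁ w₂ :=
    M.load_value_max hrf₂ w₁ (M.rf_write hrf₁) ((M.rf_addr hrf₁).trans ha) h hne
  rcases M.load_value_mem hrf₁ with hp | hm
  · exact visible (Or.inl (M.po_trans hp hpo))
  by_cases hw : ∃ w, M.isWrite w ∧ M.addr w = M.addr r₁ ∧ M.po r₁ w ∧ M.po w r₂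
  · obtain ⟨w, hww, haw, h₁, h₂⟩ := hw
    have hmw : M.mo w₁ w := M.mo_trans hm (M.inst_order (M.ppo_rw hr₁ hww haw.symm h₁))
    by_cases he : w = w₂
    · exact he ▸ hmw
    · exact M.mo_trans hmw (M.load_value_max hrf₂ w hww (haw.trans ha) (Or.inl h₂) he)
  · refine visible (Or.inr (M.mo_trans hm (M.inst_order (M.ppo_rr hr₁ hr₂ ha hpo ?_))))
    exact fun w hww haw h₁ h₂ => hw ⟨w, hww, haw, h₁, h₂⟩
end

section
/- (Claim used in the COM ⊆ GAM proof: internal reads-from edges follow program order) Assume the COM axioms hold. If w rf r and tid w = tid r, then w po r. -/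
universe u v w

/-- Claim used in the COM ⊆ GAM proof: under the COM axioms, internal
reads-from edges follow program order: if `w rf r` and `w`, `r` are on the
same thread, then `w po r`. -/
theorem com_rfi_po {E : Type u} {A : Type v} {T : Type w} (M : COM E A T)
    (hSC : M.ScPerLocation) (hCaus : M.Causality)
    (w r : E) (hrf : M.rf w r) (htid : M.tid w = M.tid r) :
    M.po w r := by
  have hne : w ≠ r := fun h =>
    M.not_read_and_write r ⟨M.rf_read hrf, h ▸ M.rf_write hrf⟩
  refine (M.po_total w r htid hne).resolve_right fun hpo => ?_
  have hloc : M.poloc r w := ⟨hpo, (M.rf_addr hrf).symm⟩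
  exact hSC w (.tail (.single (Or.inl hrf)) (Or.inr (Or.inr (Or.inr hloc))))
end

section
/- (Theorem: COM ⊆ GAM, existence of a witnessing memory order) Assume E is finite and the COM axioms hold. Then there exists a strict total order mo on E containing rfe ∪ co ∪ fr ∪ ppo, and any such mo satisfies both GAM axioms: ppo ⊆ mo (Inst-Order), and if w rf r then w is the mo-greatest element of the set { w' : w' is a write, addr w' = addr r, and (w' po r or w' mo r) } (Load-Value). -/
universe u v w

/-- Every acyclic relation is contained in a strict total order. -/
theorem Acyclic.exists_strict_total_extension {E : Type u} {r : E → E → Prop}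
    (h : Acyclic r) :
    ∃ s : E → E → Prop,
      (∀ e, ¬ s e e) ∧ (∀ a b c, s a b → s b c → s a c) ∧
      (∀ a b, a ≠ b → s a b ∨ s b a) ∧ (∀ x y, r x y → s x y) := by
  have hp : IsPartialOrder E (Relation.ReflTransGen r) :=
    { refl := fun _ => .refl
      trans := fun _ _ _ => .trans
      antisymm := fun a b hab hba => by
        rcases Relation.reflTransGen_iff_eq_or_transGen.1 hab with hab | hab
        · exact hab.symm
        · exact (h a (hab.trans_left hba)).elim }
  obtain ⟨s, hs, hrs⟩ := extend_partialOrder (Relation.ReflTransGen r)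
  refine ⟨fun a b => s a b ∧ a ≠ b, fun e he => he.2 rfl, ?_, ?_, ?_⟩
  · rintro a b c ⟨hab, hne⟩ ⟨hbc, -⟩
    refine ⟨hs.trans _ _ _ hab hbc, ?_⟩
    rintro rfl
    exact hne (hs.antisymm _ _ hab hbc)
  · intro a b hne
    exact (hs.total a b).imp (fun hab => ⟨hab, hne⟩) (fun hba => ⟨hba, hne.symm⟩)
  · intro x y hxy
    refine ⟨hrs _ _ (.single hxy), ?_⟩
    rintro rfl
    exact h x (.single hxy)

namespace COM

variable {E : Type u} {A : Type v} {T : Type w} {M : COM E A T}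

/-- A read never precedes, in program order, the write it reads from. -/
theorem ScPerLocation.not_po_of_rf (hSC : M.ScPerLocation) {w r : E} (h : M.rf w r) :
    ¬ M.po r w := fun hrw =>
  hSC w (.tail (.single (Or.inl h)) (Or.inr (Or.inr (Or.inr ⟨hrw, (M.rf_addr h).symm⟩))))

/-- A read never follows, in program order, a write that is coherence-after its source. -/
theorem ScPerLocation.not_po_of_fr (hSC : M.ScPerLocation) {r w : E} (h : M.fr r w)
    (haddr : M.addr w = M.addr r) : ¬ M.po w r := fun hwr =>
  hSC r (.tail (.single (Or.inr (Or.inr (Or.inl h)))) (Or.inr (Or.inr (Or.inr ⟨hwr, haddr⟩))))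

/-- A read's source precedes it in program order or is on a different thread. -/
theorem ScPerLocation.po_or_rfe_of_rf (hSC : M.ScPerLocation) {w r : E} (h : M.rf w r) :
    M.po w r ∨ M.rfe w r := by
  by_cases ht : M.tid w = M.tid r
  · have hne : w ≠ r := by
      rintro rfl
      exact M.not_read_and_write w ⟨M.rf_read h, M.rf_write h⟩
    exact Or.inl ((M.po_total w r ht hne).resolve_right (hSC.not_po_of_rf h))
  · exact Or.inr ⟨h, ht⟩

end COM

/-- Theorem (COM ⊆ GAM, existence of a witnessing memory order): if `E` is
finite and the COM axioms hold, then there exists a strict total order `mo`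
containing `rfe ∪ co ∪ fr ∪ ppo`, and any such `mo` satisfies both GAM axioms
(Inst-Order and Load-Value). -/
theorem com_subset_gam {E : Type u} {A : Type v} {T : Type w} [Finite E]
    (M : COM E A T) (hSC : M.ScPerLocation) (hCaus : M.Causality) :
    (∃ mo : E → E → Prop,
      (∀ e, ¬ mo e e) ∧ (∀ a b c, mo a b → mo b c → mo a c) ∧
      (∀ a b, a ≠ b → mo a b ∨ mo b a) ∧
      (∀ x y, (M.rfe x y ∨ M.co x y ∨ M.fr x y ∨ M.ppo x y) → mo x y)) ∧
    (∀ mo : E → E → Prop,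
      (∀ e, ¬ mo e e) → (∀ a b c, mo a b → mo b c → mo a c) →
      (∀ a b, a ≠ b → mo a b ∨ mo b a) →
      (∀ x y, (M.rfe x y ∨ M.co x y ∨ M.fr x y ∨ M.ppo x y) → mo x y) →
      (∀ x y, M.ppo x y → mo x y) ∧
      (∀ w r, M.rf w r →
        (M.isWrite w ∧ M.addr w = M.addr r ∧ (M.po w r ∨ mo w r)) ∧
        (∀ w', M.isWrite w' → M.addr w' = M.addr r → (M.po w' r ∨ mo w' r) →
          w' ≠ w → mo w' w))) := by
  refine ⟨hCaus.exists_strict_total_extension, fun mo hirr htrans _ hsub => ⟨?_, ?_⟩⟩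
  · exact fun x y h => hsub x y (Or.inr (Or.inr (Or.inr h)))
  · intro w r hwr
    refine ⟨⟨M.rf_write hwr, M.rf_addr hwr, ?_⟩, ?_⟩
    · exact (hSC.po_or_rfe_of_rf hwr).imp_right fun h => hsub w r (Or.inl h)
    · intro w' hw' haddr hbefore hne
      rcases M.co_total w' w hw' (M.rf_write hwr) (haddr.trans (M.rf_addr hwr).symm) hne
        with hco | hco
      · exact hsub w' w (Or.inr (Or.inl hco))
      · have hfr : M.fr r w' := ⟨w, hwr, hco⟩
        rcases hbefore with hpo | hmo
        · exact (hSC.not_po_of_fr hfr haddr hpo).elim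
        · exact (hirr r (htrans r w' r (hsub r w' (Or.inr (Or.inr (Or.inl hfr)))) hmo)).elim
end
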